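/- Let (S,μ) be a series-parallel labelled poset and x ∈ S. Then E(S,μ) and E(S∖x, μ) are real-rooted and E(S∖x, μ) ⪯ E(S,μ). -/

import Mathlib

open Polynomial

/-- A real polynomial is real-rooted if it is nonzero and all of its complex zeros are real. -/
def RealRooted (f : Polynomial ℝ) : Prop :=
  f ≠ 0 ∧ ∀ z : ℂ, (f.map (algebraMap ℝ ℂ)).IsRoot z → z.im = 0

/-- The zeros of `f`, listed in increasing order (with multiplicity). -/
noncomputable def sortedRoots (f : Polynomial ℝ) : List ℝ :=
  f.roots.sort (· ≤ ·)

/-- `g ⪯ f`: interlacing. Both are real-rooted, `deg f = deg g + 1`, and listing the zeros of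
`f` as `α₁ ≤ ⋯ ≤ α_d` and of `g` as `β₁ ≤ ⋯ ≤ β_{d-1}` (with multiplicity, in increasing
order), one has `α₁ ≤ β₁ ≤ α₂ ≤ ⋯ ≤ β_{d-1} ≤ α_d`. -/
def Interlaces (g f : Polynomial ℝ) : Prop :=
  RealRooted f ∧ RealRooted g ∧ f.natDegree = g.natDegree + 1 ∧
  ∀ i, i < g.natDegree →
    (sortedRoots f).getD i 0 ≤ (sortedRoots g).getD i 0 ∧
    (sortedRoots g).getD i 0 ≤ (sortedRoots f).getD (i + 1) 0

/-- `g ≺ f`: strict interlacing, where all the inequalities above are strict. -/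
def StrictInterlaces (g f : Polynomial ℝ) : Prop :=
  RealRooted f ∧ RealRooted g ∧ f.natDegree = g.natDegree + 1 ∧
  ∀ i, i < g.natDegree →
    (sortedRoots f).getD i 0 < (sortedRoots g).getD i 0 ∧
    (sortedRoots g).getD i 0 < (sortedRoots f).getD (i + 1) 0

/-- `σ : P → {1,…,k}` (realised as `Fin k`) is a `(P,ω)`-partition if it is order reversing
and `x < y` with `ω x > ω y` implies `σ x > σ y`. -/
def IsPPartition {α : Type*} [PartialOrder α] (ω : α → ℕ) {k : ℕ} (σ : α → Fin k) : Prop :=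
  (∀ x y : α, x ≤ y → σ y ≤ σ x) ∧ (∀ x y : α, x < y → ω y < ω x → σ y < σ x)

/-- The `E`-polynomial `E(P,ω) = Σₖ e_k(P,ω) xᵏ`, where `e_k(P,ω)` is the number of
surjective `(P,ω)`-partitions `σ : P → {1,…,k}`. -/
noncomputable def Epoly (α : Type*) [PartialOrder α] (ω : α → ℕ) : Polynomial ℝ :=
  ∑ k ∈ Finset.range (Nat.card α + 1),
    C ((Nat.card {σ : α → Fin k // Function.Surjective σ ∧ IsPPartition ω σ} : ℕ) : ℝ) * X ^ k

instance (α β : Type) [Finite α] [Finite β] : Finite (α ⊕ₗ β) :=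
  inferInstanceAs (Finite (α ⊕ β))

/-- A finite labelled poset: a finite poset together with an injective labelling into `ℕ`. -/
structure LPoset where
  carrier : Type
  [ord : PartialOrder carrier]
  [fin : Finite carrier]
  label : carrier → ℕ
  inj : Function.Injective label

attribute [instance] LPoset.ord LPoset.fin

/-- The class of series-parallel labelled posets: the smallest class containing the empty
poset and the one-element labelled posets, and closed under ordinal sums `(P ⊕ Q, ω ⊕₀ ν)`,
`(P ⊕ Q, ω ⊕₁ ν)` and disjoint unions `(P ⊔ Q, ω ⊔ ν)`. -/
inductive SeriesParallel : LPoset → Prop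
  | empty (S : LPoset) (h : IsEmpty S.carrier) : SeriesParallel S
  | single (S : LPoset) (h : Nat.card S.carrier = 1) : SeriesParallel S
  | osum0 (P Q : LPoset) (hP : SeriesParallel P) (hQ : SeriesParallel Q)
      (μ : P.carrier ⊕ Q.carrier → ℕ) (hμ : Function.Injective μ)
      (h1 : ∀ x y : P.carrier, P.label x < P.label y → μ (Sum.inl x) < μ (Sum.inl y))
      (h2 : ∀ x y : Q.carrier, Q.label x < Q.label y → μ (Sum.inr x) < μ (Sum.inr y))
      (h3 : ∀ (x : P.carrier) (y : Q.carrier), μ (Sum.inl x) < μ (Sum.inr y)) :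
      SeriesParallel ⟨P.carrier ⊕ₗ Q.carrier, fun p => μ (ofLex p),
        fun _ _ hab => ofLex.injective (hμ hab)⟩
  | osum1 (P Q : LPoset) (hP : SeriesParallel P) (hQ : SeriesParallel Q)
      (μ : P.carrier ⊕ Q.carrier → ℕ) (hμ : Function.Injective μ)
      (h1 : ∀ x y : P.carrier, P.label x < P.label y → μ (Sum.inl x) < μ (Sum.inl y))
      (h2 : ∀ x y : Q.carrier, Q.label x < Q.label y → μ (Sum.inr x) < μ (Sum.inr y))
      (h3 : ∀ (x : Q.carrier) (y : P.carrier), μ (Sum.inr x) < μ (Sum.inl y)) :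
      SeriesParallel ⟨P.carrier ⊕ₗ Q.carrier, fun p => μ (ofLex p),
        fun _ _ hab => ofLex.injective (hμ hab)⟩
  | dunion (P Q : LPoset) (hP : SeriesParallel P) (hQ : SeriesParallel Q)
      (μ : P.carrier ⊕ Q.carrier → ℕ) (hμ : Function.Injective μ)
      (h1 : ∀ x y : P.carrier, P.label x < P.label y → μ (Sum.inl x) < μ (Sum.inl y))
      (h2 : ∀ x y : Q.carrier, Q.label x < Q.label y → μ (Sum.inr x) < μ (Sum.inr y)) :
      SeriesParallel ⟨P.carrier ⊕ Q.carrier, μ, hμ⟩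

/-- The truncated diamond product `∑_{j < N} f⁽ʲ⁾ g⁽ʲ⁾ / (j!)² · (x (x + 1))ʲ`. -/
noncomputable def diamond (N : ℕ) (f g : ℝ[X]) : ℝ[X] :=
  ∑ j ∈ Finset.range N, hasseDeriv j f * hasseDeriv j g * (X * (X + 1)) ^ j

/-- The functional sending `X ^ k` to the binomial coefficient `n.choose k`. -/
noncomputable def binomEval (n : ℕ) (f : ℝ[X]) : ℝ :=
  ∑ k ∈ Finset.range (n + 1), f.coeff k * n.choose k

theorem hasseDeriv_succ_X_mul (f : ℝ[X]) (j : ℕ) :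
    hasseDeriv (j + 1) (X * f) = X * hasseDeriv (j + 1) f + hasseDeriv j f := by
  ext n
  cases n with
  | zero => simp [hasseDeriv_coeff, coeff_X_mul]
  | succ n =>
    have h : n + 1 + (j + 1) = (n + j + 1) + 1 := by ring
    simp only [hasseDeriv_coeff, coeff_add, coeff_X_mul, h]
    rw [Nat.choose_succ_succ (n + j + 1) j, show n + (j + 1) = n + j + 1 by ring,
      show n + 1 + j = n + j + 1 by ring]
    push_cast
    ring

theorem binomEval_add (n : ℕ) (f g : ℝ[X]) :
    binomEval n (f + g) = binomEval n f + binomEval n g := by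
  simp [binomEval, add_mul, Finset.sum_add_distrib]

theorem binomEval_C_mul (n : ℕ) (c : ℝ) (f : ℝ[X]) :
    binomEval n (C c * f) = c * binomEval n f := by
  simp [binomEval, Finset.mul_sum, mul_assoc]

theorem binomEval_one (n : ℕ) : binomEval n 1 = 1 := by
  simp [binomEval, coeff_one]

theorem binomEval_zero (f : ℝ[X]) : binomEval 0 f = f.coeff 0 := by
  simp [binomEval]

theorem binomEval_succ_X_mul (n : ℕ) (f : ℝ[X]) :
    binomEval (n + 1) (X * f) = binomEval n ((X + 1) * f) := by
  rw [add_mul, one_mul, binomEval_add]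
  simp only [binomEval]
  rw [Finset.sum_range_succ' _ (n + 1),
    Finset.sum_range_succ' (fun k => (X * f : ℝ[X]).coeff k * (n.choose k : ℝ)) n]
  simp only [coeff_X_mul, coeff_X_mul_zero, zero_mul, add_zero, Nat.choose_succ_succ, Nat.cast_add,
    mul_add, Finset.sum_add_distrib]
  rw [add_comm, Finset.sum_range_succ (fun k => f.coeff k * (n.choose (k + 1) : ℝ)) n]
  simp

theorem binomEval_injective {f g : ℝ[X]} (h : ∀ n, binomEval n f = binomEval n g) : f = g := by
  ext n
  induction n using Nat.strong_induction_on with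
  | _ n ih =>
    have := h n
    simp only [binomEval, Finset.sum_range_succ, Nat.choose_self, Nat.cast_one, mul_one] at this
    rw [Finset.sum_congr rfl fun k hk => by rw [ih k (Finset.mem_range.1 hk)]] at this
    linarith

theorem diamond_add_left (N : ℕ) (f₁ f₂ g : ℝ[X]) :
    diamond N (f₁ + f₂) g = diamond N f₁ g + diamond N f₂ g := by
  simp [diamond, add_mul, Finset.sum_add_distrib]

theorem diamond_add_right (N : ℕ) (f g₁ g₂ : ℝ[X]) :
    diamond N f (g₁ + g₂) = diamond N f g₁ + diamond N f g₂ := by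
  simp [diamond, mul_add, add_mul, Finset.sum_add_distrib]

theorem diamond_C_left (N : ℕ) (c : ℝ) (g : ℝ[X]) : diamond (N + 1) (C c) g = C c * g := by
  simp [diamond, Finset.sum_range_succ', hasseDeriv_C]

theorem diamond_C_right (N : ℕ) (c : ℝ) (f : ℝ[X]) : diamond (N + 1) f (C c) = C c * f := by
  simp [diamond, Finset.sum_range_succ', hasseDeriv_C, mul_comm]

theorem diamond_linear_mul_linear_mul (N : ℕ) (a : ℝ) (f g : ℝ[X]) (hg : hasseDeriv N g = 0) :
    diamond (N + 1) ((X + C a) * f) ((X + C a) * g) =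
      ((X + C a) ^ 2 + X * (X + 1)) * diamond N f g +
        (X + C a) * ∑ j ∈ Finset.range N,
          (hasseDeriv (j + 1) f * hasseDeriv j g + hasseDeriv j f * hasseDeriv (j + 1) g)
            * (X * (X + 1)) ^ (j + 1) := by
  have hA : diamond N f g = f * g + ∑ j ∈ Finset.range N,
      hasseDeriv (j + 1) f * hasseDeriv (j + 1) g * (X * (X + 1)) ^ (j + 1) := by
    have := Finset.sum_range_succ
      (fun j => hasseDeriv j f * hasseDeriv j g * (X * (X + 1)) ^ j) N
    rw [Finset.sum_range_succ', hg] at this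
    simp only [hasseDeriv_zero', pow_zero, mul_zero, zero_mul, add_zero, mul_one] at this
    rw [diamond, ← this]
    ring
  have hlin : ∀ (j : ℕ) (p : ℝ[X]), hasseDeriv (j + 1) ((X + C a) * p) =
      (X + C a) * hasseDeriv (j + 1) p + hasseDeriv j p := by
    intro j p
    rw [add_mul, map_add, hasseDeriv_succ_X_mul, ← smul_eq_C_mul, map_smul, smul_eq_C_mul]
    ring
  generalize hL : X + C a = L at *
  rw [add_mul]
  nth_rw 1 [hA]
  rw [diamond, diamond, Finset.sum_range_succ', mul_add (L ^ 2)]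
  simp only [hlin, hasseDeriv_zero', pow_zero, mul_one]
  have : ∑ j ∈ Finset.range N, (L * hasseDeriv (j + 1) f + hasseDeriv j f) *
      (L * hasseDeriv (j + 1) g + hasseDeriv j g) * (X * (X + 1)) ^ (j + 1) =
      L ^ 2 * (∑ j ∈ Finset.range N,
        hasseDeriv (j + 1) f * hasseDeriv (j + 1) g * (X * (X + 1)) ^ (j + 1)) +
      X * (X + 1) * (∑ j ∈ Finset.range N,
        hasseDeriv j f * hasseDeriv j g * (X * (X + 1)) ^ j) +
      L * ∑ j ∈ Finset.range N,
        (hasseDeriv (j + 1) f * hasseDeriv j g + hasseDeriv j f * hasseDeriv (j + 1) g)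
          * (X * (X + 1)) ^ (j + 1) := by
    simp only [Finset.mul_sum, ← Finset.sum_add_distrib]
    exact Finset.sum_congr rfl fun j _ => by ring
  rw [this]
  ring

theorem diamond_X_mul_X_mul (N : ℕ) (f g : ℝ[X]) (hg : (X * g).natDegree < N + 1) :
    ∃ H : ℝ[X], diamond (N + 1) (X * f) (X * g) = X * H ∧
      diamond (N + 1) ((X + 1) * f) ((X + 1) * g) = (X + 1) * H := by
  have hgN : hasseDeriv N g = 0 := by
    by_cases h0 : g = 0
    · simp [h0]
    · apply hasseDeriv_eq_zero_of_lt_natDegree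
      rw [natDegree_X_mul h0] at hg
      omega
  have h0 := diamond_linear_mul_linear_mul N 0 f g hgN
  have h1 := diamond_linear_mul_linear_mul N 1 f g hgN
  rw [C_0, add_zero] at h0
  rw [C_1] at h1
  refine ⟨(2 * X + 1) * diamond N f g + ∑ j ∈ Finset.range N,
    (hasseDeriv (j + 1) f * hasseDeriv j g + hasseDeriv j f * hasseDeriv (j + 1) g)
      * (X * (X + 1)) ^ (j + 1), ?_, ?_⟩
  · rw [h0]
    ring
  · rw [h1]
    ring

theorem binomEval_diamond (n N : ℕ) (f g : ℝ[X]) (hg : g.natDegree < N + 1) :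
    binomEval n (diamond (N + 1) f g) = binomEval n f * binomEval n g := by
  induction n generalizing f g with
  | zero =>
    simp only [binomEval_zero, diamond, finsetSum_coeff]
    rw [Finset.sum_range_succ']
    simp [coeff_zero_eq_eval_zero]
  | succ n ih =>
    have hf' : f = X * f.divX + C (f.coeff 0) := (X_mul_divX_add f).symm
    have hg' : g = X * g.divX + C (g.coeff 0) := (X_mul_divX_add g).symm
    have hX : (X * g.divX).natDegree < N + 1 := by
      by_cases h0 : g.divX = 0
      · simp [h0]
      · rw [natDegree_X_mul h0, natDegree_divX_eq_natDegree_tsub_one]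
        have : g.natDegree ≠ 0 := fun h => h0 (divX_eq_zero_iff.2 (eq_C_of_natDegree_eq_zero h))
        omega
    have hX1 : ((X + 1) * g.divX).natDegree < N + 1 := by
      by_cases h0 : g.divX = 0
      · simp [h0]
      · rw [natDegree_mul (by simpa using X_add_C_ne_zero (1 : ℝ)) h0,
          show (X + 1 : ℝ[X]) = X + C 1 by simp, natDegree_X_add_C]
        rw [natDegree_X_mul h0] at hX
        omega
    obtain ⟨H, h1, h2⟩ := diamond_X_mul_X_mul N f.divX g.divX hX
    have hc : ∀ c : ℝ, binomEval (n + 1) (C c) = c := fun c => by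
      have := binomEval_C_mul (n + 1) c 1
      rwa [binomEval_one, mul_one, mul_one] at this
    have key : binomEval (n + 1) (diamond (N + 1) (X * f.divX) (X * g.divX)) =
        binomEval (n + 1) (X * f.divX) * binomEval (n + 1) (X * g.divX) := by
      rw [h1, binomEval_succ_X_mul, ← h2, ih _ _ hX1, binomEval_succ_X_mul, binomEval_succ_X_mul]
    rw [hf', hg']
    simp only [diamond_add_left, diamond_add_right, diamond_C_left, diamond_C_right, binomEval_add,
      key, binomEval_C_mul, hc]
    ring

theorem coeff_ne_zero_of_roots_subset_convex {K : Set ℂ} (hK : Convex ℝ K) (h0 : (0 : ℂ) ∉ K)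
    (m : ℕ) (p : ℂ[X]) (hp : p ≠ 0) (hroots : ∀ z, p.IsRoot z → z ∈ K) (hm : m ≤ p.natDegree) :
    p.coeff m ≠ 0 := by
  induction m generalizing p with
  | zero =>
    intro h
    exact h0 (hroots 0 (by rwa [IsRoot, ← coeff_zero_eq_eval_zero]))
  | succ m ih =>
    have hdeg : 0 < p.degree := natDegree_pos_iff_degree_pos.1 (by omega)
    have hd : p.derivative.natDegree = p.natDegree - 1 := natDegree_derivative p
    have hd0 : p.derivative ≠ 0 := fun h => by
      have := derivative_eq_zero.1 h
      omega
    have := ih p.derivative hd0 (fun z hz => ?_) (by omega)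
    · rw [coeff_derivative] at this
      exact left_ne_zero_of_mul this
    · have hz' : z ∈ p.derivative.rootSet ℂ := by
        rw [mem_rootSet, coe_aeval_eq_eval]
        exact ⟨hd0, hz⟩
      refine convexHull_min ?_ hK (rootSet_derivative_subset_convexHull_rootSet hdeg hz')
      intro y hy
      rw [mem_rootSet, coe_aeval_eq_eval] at hy
      exact hroots y hy.2

theorem sum_hasseDeriv_mul_ne_zero {K : Set ℂ} (hK : Convex ℝ K) (h0 : (0 : ℂ) ∉ K)
    (F g : ℂ[X]) (x w : ℂ) (hF : F ≠ 0) (hw : w ≠ 0) (hgx : g.eval x ≠ 0)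
    (hFK : ∀ a, F.IsRoot a → a - x ∈ K) (hgK : ∀ b, g.IsRoot b → w / (b - x) ∈ K) :
    ∑ j ∈ Finset.range (g.natDegree + 1),
      (hasseDeriv j F).eval x * (hasseDeriv j g).eval x * w ^ j ≠ 0 := by
  set m := g.natDegree with hm
  set c : ℕ → ℂ := fun j => (hasseDeriv j g).eval x * w ^ j with hc
  set G : ℂ[X] := ∑ j ∈ Finset.range (m + 1), C (c j) * X ^ (m - j) with hG
  have hg0 : g ≠ 0 := by rintro rfl; simp at hgx
  have hGcoeff : ∀ j ≤ m, G.coeff (m - j) = c j := by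
    intro j hj
    rw [hG, finsetSum_coeff, Finset.sum_eq_single j]
    · simp
    · intro i hi hij
      rw [Finset.mem_range] at hi
      rw [coeff_C_mul_X_pow, if_neg (by omega)]
    · intro h
      exact absurd (Finset.mem_range.2 (by omega)) h
  have hGm : G.coeff m ≠ 0 := by
    have := hGcoeff 0 (by omega)
    rw [Nat.sub_zero] at this
    simpa [this, hc] using hgx
  have hG0 : G ≠ 0 := by rintro h; simp [h] at hGm
  have hGdeg : G.natDegree = m := by
    refine le_antisymm ?_ (le_natDegree_of_ne_zero hGm)
    refine natDegree_sum_le_of_forall_le _ _ fun j _ => ?_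
    exact (natDegree_C_mul_X_pow_le _ _).trans (by omega)
  have hT0 : taylor x F ≠ 0 := by rwa [Ne, taylor_eq_zero]
  have hdeg : (taylor x F * G).natDegree = F.natDegree + m := by
    rw [natDegree_mul hT0 hG0, natDegree_taylor, hGdeg]
  have key := coeff_ne_zero_of_roots_subset_convex hK h0 m (taylor x F * G) (mul_ne_zero hT0 hG0)
    ?_ (by omega)
  · rw [coeff_mul, Finset.Nat.sum_antidiagonal_eq_sum_range_succ_mk] at key
    convert key using 1
    refine Finset.sum_congr rfl fun j hj => ?_
    rw [Finset.mem_range] at hj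
    rw [hGcoeff j (by omega), taylor_coeff, mul_assoc]
  · intro z hz
    rw [root_mul] at hz
    rcases hz with hz | hz
    · rw [IsRoot, taylor_eval] at hz
      simpa using hFK _ hz
    · have hz0 : z ≠ 0 := by
        rintro rfl
        rw [IsRoot, ← coeff_zero_eq_eval_zero] at hz
        have := hGcoeff m le_rfl
        rw [Nat.sub_self, hz, hc] at this
        simp only [hm, hasseDeriv_natDegree_eq_C, eval_C] at this
        exact mul_ne_zero (leadingCoeff_ne_zero.2 hg0) (pow_ne_zero _ hw) this.symm
      have heval : G.eval z = z ^ m * g.eval (w / z + x) := by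
        rw [← taylor_eval, eval_eq_sum_range (p := taylor x g), natDegree_taylor, hG, eval_finsetSum,
          Finset.mul_sum]
        refine Finset.sum_congr rfl fun j hj => ?_
        rw [Finset.mem_range] at hj
        have : z ^ m = z ^ (m - j) * z ^ j := by rw [← pow_add]; congr 1; omega
        rw [taylor_coeff, this, div_pow]
        simp only [hc, eval_mul, eval_C, eval_pow, eval_X]
        field_simp
      have hroot : g.IsRoot (w / z + x) := by
        rw [IsRoot, heval] at hz
        exact (mul_eq_zero.1 hz).resolve_left (pow_ne_zero _ hz0)
      have := hgK _ hroot
      rwa [add_sub_cancel_right, div_div_cancel₀ hw] at this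

/-- All complex zeros of `f` are real and lie in `[-1, 0]`. -/
def UnitRooted (f : ℝ[X]) : Prop :=
  ∀ z : ℂ, aeval z f = 0 → z.im = 0 ∧ -1 ≤ z.re ∧ z.re ≤ 0

/-- `f + y h` does not vanish at points of the upper half-plane when `y` is in the upper
half-plane. -/
def StablePair (h f : ℝ[X]) : Prop :=
  ∀ u y : ℂ, 0 < u.im → 0 < y.im → aeval u f + y * aeval u h ≠ 0

theorem UnitRooted.ne_zero {f : ℝ[X]} (hf : UnitRooted f) : f ≠ 0 := by
  rintro rfl
  have := (hf 1 (by simp)).2.2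
  norm_num at this

theorem UnitRooted.aeval_ne_zero {f : ℝ[X]} (hf : UnitRooted f) {z : ℂ} (hz : 0 < z.im) :
    aeval z f ≠ 0 := fun h => hz.ne' (hf z h).1

theorem hasseDeriv_map_complex (f : ℝ[X]) (j : ℕ) :
    hasseDeriv j (f.map (algebraMap ℝ ℂ)) = (hasseDeriv j f).map (algebraMap ℝ ℂ) := by
  ext n
  simp [hasseDeriv_coeff]

theorem im_mul_div_sub_neg {x b : ℂ} (hx : 0 < x.im) (hb : b.im = 0 ∧ -1 ≤ b.re ∧ b.re ≤ 0) :
    (x * (x + 1) / (b - x)).im < 0 := by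
  obtain ⟨hb0, hb1, hb2⟩ := hb
  have hne : b - x ≠ 0 := fun h => by
    have := congrArg Complex.im h
    simp [hb0] at this
    exact hx.ne' this
  have hpos : 0 < Complex.normSq (b - x) := Complex.normSq_pos.2 hne
  rw [Complex.div_im, div_sub_div_same]
  refine div_neg_of_neg_of_pos ?_ hpos
  simp only [Complex.mul_im, Complex.mul_re, Complex.add_re, Complex.add_im, Complex.one_re,
    Complex.one_im, Complex.sub_re, Complex.sub_im, hb0]
  nlinarith [mul_nonneg hx.le (sq_nonneg (x.re - b.re)), mul_pos hx (mul_pos hx hx),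
    mul_nonneg hx.le (mul_nonneg (neg_nonneg.2 hb2) (by linarith : 0 ≤ b.re + 1))]

theorem aeval_diamond (N : ℕ) (f g : ℝ[X]) (x : ℂ) :
    aeval x (diamond N f g) = ∑ j ∈ Finset.range N,
      (hasseDeriv j (f.map (algebraMap ℝ ℂ))).eval x *
        (hasseDeriv j (g.map (algebraMap ℝ ℂ))).eval x * (x * (x + 1)) ^ j := by
  simp [diamond, map_sum, hasseDeriv_map_complex, eval_map_algebraMap]

theorem UnitRooted.sum_hasseDeriv_ne_zero {g : ℝ[X]} (hg : UnitRooted g) {F : ℂ[X]}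
    (hF : ∀ z : ℂ, 0 < z.im → F.eval z ≠ 0) {x : ℂ} (hx : 0 < x.im) :
    ∑ j ∈ Finset.range (g.natDegree + 1), (hasseDeriv j F).eval x *
        (hasseDeriv j (g.map (algebraMap ℝ ℂ))).eval x * (x * (x + 1)) ^ j ≠ 0 := by
  rw [← natDegree_map (algebraMap ℝ ℂ) (p := g)]
  have hx0 : x ≠ 0 := by rintro rfl; simp at hx
  have hx1 : x + 1 ≠ 0 := fun h => by
    have := congrArg Complex.im h
    simp at this
    exact hx.ne' this
  refine sum_hasseDeriv_mul_ne_zero (convex_halfSpace_im_lt 0) (by simp) F _ x _ ?_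
    (mul_ne_zero hx0 hx1) ?_ ?_ ?_
  · rintro rfl
    exact hF x hx (by simp)
  · rw [eval_map_algebraMap]
    exact hg.aeval_ne_zero hx
  · intro a ha
    have : a.im ≤ 0 := not_lt.1 fun h => hF a h ha
    simp only [Set.mem_ofPred_eq, Complex.sub_im]
    linarith
  · intro b hb
    rw [IsRoot, eval_map_algebraMap] at hb
    exact im_mul_div_sub_neg hx (hg b hb)

theorem StablePair.diamond {h f g : ℝ[X]} (hg : UnitRooted g) (hhf : StablePair h f) :
    StablePair (diamond (g.natDegree + 1) h g) (diamond (g.natDegree + 1) f g) := by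
  intro u y hu hy
  have := hg.sum_hasseDeriv_ne_zero
    (F := f.map (algebraMap ℝ ℂ) + C y * h.map (algebraMap ℝ ℂ)) (fun z hz => by
      simpa [eval_map_algebraMap] using hhf z y hz hy) hu
  rw [aeval_diamond, aeval_diamond, Finset.mul_sum, ← Finset.sum_add_distrib]
  convert this using 1
  refine Finset.sum_congr rfl fun j _ => ?_
  rw [map_add, ← smul_eq_C_mul, map_smul, eval_add, eval_smul, smul_eq_mul]
  ring

theorem UnitRooted.diamond {f g : ℝ[X]} (hf : UnitRooted f) (hg : UnitRooted g) :
    UnitRooted (diamond (g.natDegree + 1) f g) := by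
  have upper : ∀ z : ℂ, 0 < z.im → aeval z (_root_.diamond (g.natDegree + 1) f g) ≠ 0 := by
    intro z hz
    rw [aeval_diamond]
    exact hg.sum_hasseDeriv_ne_zero (fun z hz => by
      rw [eval_map_algebraMap]; exact hf.aeval_ne_zero hz) hz
  have real : ∀ t : ℝ, t < -1 ∨ 0 < t →
      aeval (t : ℂ) (_root_.diamond (g.natDegree + 1) f g) ≠ 0 := by
    intro t ht
    have hw : 0 < t * (t + 1) := by rcases ht with ht | ht <;> nlinarith
    have hw' : (t : ℂ) * (t + 1) = ((t * (t + 1) : ℝ) : ℂ) := by push_cast; ring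
    have hout : ∀ p : ℝ[X], UnitRooted p → aeval (t : ℂ) p ≠ 0 := fun p hp h => by
      have := hp _ h
      simp only [Complex.ofReal_re] at this
      rcases ht with ht | ht <;> linarith [this.2.1, this.2.2]
    have hquot : ∀ b : ℂ, b.im = 0 →
        ((t : ℂ) * (t + 1) / (b - t)).re = t * (t + 1) / (b.re - t) := by
      intro b hb
      have : b = (b.re : ℂ) := Complex.ext rfl (by simp [hb])
      rw [hw', this, ← Complex.ofReal_sub, ← Complex.ofReal_div, Complex.ofReal_re,
        Complex.ofReal_re]
    rw [aeval_diamond, ← natDegree_map (algebraMap ℝ ℂ) (p := g)]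
    have hf0 : f.map (algebraMap ℝ ℂ) ≠ 0 := (Polynomial.map_ne_zero_iff
      (algebraMap ℝ ℂ).injective).2 hf.ne_zero
    have hwc : (t : ℂ) * (t + 1) ≠ 0 := by
      rw [hw']
      exact_mod_cast hw.ne'
    have hgt : (g.map (algebraMap ℝ ℂ)).eval (t : ℂ) ≠ 0 := by
      rw [eval_map_algebraMap]
      exact hout g hg
    rcases ht with ht | ht
    · refine sum_hasseDeriv_mul_ne_zero (convex_halfSpace_re_gt 0) (by simp) _ _ _ _ hf0 hwc hgt
        ?_ ?_
      · intro a ha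
        rw [IsRoot, eval_map_algebraMap] at ha
        have := hf a ha
        simp only [Set.mem_ofPred_eq, Complex.sub_re, Complex.ofReal_re]
        linarith [this.2.1]
      · intro b hb
        rw [IsRoot, eval_map_algebraMap] at hb
        have := hg b hb
        simp only [Set.mem_ofPred_eq]
        rw [hquot b this.1]
        exact div_pos hw (by linarith [this.2.1])
    · refine sum_hasseDeriv_mul_ne_zero (convex_halfSpace_re_lt 0) (by simp) _ _ _ _ hf0 hwc hgt
        ?_ ?_
      · intro a ha
        rw [IsRoot, eval_map_algebraMap] at ha
        have := hf a ha
        simp only [Set.mem_ofPred_eq, Complex.sub_re, Complex.ofReal_re]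
        linarith [this.2.2]
      · intro b hb
        rw [IsRoot, eval_map_algebraMap] at hb
        have := hg b hb
        simp only [Set.mem_ofPred_eq]
        rw [hquot b this.1]
        exact div_neg_of_pos_of_neg hw (by linarith [this.2.2])
  intro z hz
  have him : z.im = 0 := by
    rcases lt_trichotomy z.im 0 with h | h | h
    · refine absurd ?_ (upper (starRingEnd ℂ z) (by simpa using h))
      rw [aeval_conj, hz, map_zero]
    · exact h
    · exact absurd hz (upper z h)
  have hzr : z = (z.re : ℂ) := Complex.ext rfl (by simp [him])
  refine ⟨him, ?_, ?_⟩
  · by_contra hlt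
    rw [hzr] at hz
    exact real _ (Or.inl (not_le.1 hlt)) hz
  · by_contra hlt
    rw [hzr] at hz
    exact real _ (Or.inr (not_le.1 hlt)) hz

theorem List.Pairwise.length_sub_le_countP {l : List ℝ} (hl : l.Pairwise (· ≤ ·)) {t : ℝ} {i : ℕ}
    (hi : i < l.length) (ht : t < l.getD i 0) : l.length - i ≤ l.countP (t < ·) := by
  rw [List.getD_eq_getElem _ _ hi] at ht
  calc l.length - i = (l.drop i).length := by simp
    _ = (l.drop i).countP (t < ·) := by
      rw [eq_comm, List.countP_eq_length]
      intro a ha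
      obtain ⟨j, hj, rfl⟩ := List.mem_iff_getElem.1 ha
      rw [List.getElem_drop, decide_eq_true_eq]
      rcases Nat.eq_zero_or_pos j with rfl | hj0
      · simpa using ht
      · exact ht.trans_le (List.pairwise_iff_getElem.1 hl _ _ _ _ (by omega))
    _ ≤ _ := (List.drop_sublist i l).countP_le

theorem List.Pairwise.countP_le_length_sub {l : List ℝ} (hl : l.Pairwise (· ≤ ·)) {t : ℝ} {i : ℕ}
    (hi : i < l.length) (ht : l.getD i 0 < t) : l.countP (t < ·) ≤ l.length - (i + 1) := by
  rw [List.getD_eq_getElem _ _ hi] at ht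
  have h0 : (l.take (i + 1)).countP (t < ·) = 0 := by
    rw [List.countP_eq_zero]
    intro a ha
    obtain ⟨j, hj, rfl⟩ := List.mem_iff_getElem.1 ha
    rw [List.length_take] at hj
    rw [List.getElem_take, decide_eq_true_eq, not_lt]
    rcases Nat.lt_or_ge j i with hji | hji
    · exact (List.pairwise_iff_getElem.1 hl _ _ _ _ hji).trans ht.le
    · have : j = i := by omega
      subst this
      exact ht.le
  calc l.countP (t < ·) = (l.take (i + 1)).countP (t < ·) + (l.drop (i + 1)).countP (t < ·) := by
        rw [← List.countP_append, List.take_append_drop]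
    _ ≤ l.length - (i + 1) := by
        rw [h0, zero_add]
        exact List.countP_le_length.trans (by simp)

open Filter Topology in
theorem tendsto_arg_add_real_atTop (z : ℂ) :
    Tendsto (fun s : ℝ => (z + s).arg) atTop (𝓝 0) := by
  have h1 : Tendsto (fun s : ℝ => z * ((s⁻¹ : ℝ) : ℂ) + 1) atTop (𝓝 (z * ((0 : ℝ) : ℂ) + 1)) :=
    ((Complex.continuous_ofReal.tendsto 0).comp tendsto_inv_atTop_zero).const_mul z |>.add_const 1
  rw [Complex.ofReal_zero, mul_zero, zero_add] at h1
  have h2 := (Complex.continuousAt_arg Complex.one_mem_slitPlane).tendsto.comp h1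
  rw [Complex.arg_one] at h2
  refine h2.congr' ?_
  filter_upwards [eventually_gt_atTop 0] with s hs
  have : z + s = (s : ℂ) * (z * ((s⁻¹ : ℝ) : ℂ) + 1) := by
    have : (s : ℂ) ≠ 0 := by exact_mod_cast hs.ne'
    push_cast
    field_simp
  rw [Function.comp_apply, this, Complex.arg_real_mul _ hs]

/-- The total argument of `∏ (u - a)` over the multiset `s`. -/
noncomputable def argSum (s : Multiset ℝ) (u : ℂ) : ℝ :=
  (s.map fun a : ℝ => (u - a).arg).sum

theorem argSum_cons (a : ℝ) (s : Multiset ℝ) (u : ℂ) :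
    argSum (a ::ₘ s) u = (u - a).arg + argSum s u := by
  simp [argSum]

theorem exists_prod_sub_eq_exp_argSum (s : Multiset ℝ) {u : ℂ} (hu : 0 < u.im) :
    ∃ r : ℝ, 0 < r ∧ (s.map fun a : ℝ => u - a).prod = r * Complex.exp (argSum s u * Complex.I) := by
  induction s using Multiset.induction with
  | empty => exact ⟨1, one_pos, by simp [argSum]⟩
  | cons a s ih =>
    obtain ⟨r, hr, h⟩ := ih
    have hne : u - a ≠ 0 := fun h0 => by
      have := congrArg Complex.im h0
      simp at this
      exact hu.ne' this
    refine ⟨‖u - a‖ * r, mul_pos (norm_pos_iff.2 hne) hr, ?_⟩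
    rw [Multiset.map_cons, Multiset.prod_cons, h, argSum_cons]
    nth_rw 1 [← Complex.norm_mul_exp_arg_mul_I (u - a)]
    push_cast
    rw [add_mul, Complex.exp_add]
    ring

open Filter Topology in
theorem tendsto_argSum_add_real (s : Multiset ℝ) (u : ℂ) :
    Tendsto (fun t : ℝ => argSum s (u + t)) atTop (𝓝 0) := by
  induction s using Multiset.induction with
  | empty => simp [argSum]
  | cons a s ih =>
    simp only [argSum_cons]
    have := (tendsto_arg_add_real_atTop (u - a)).add ih
    rw [add_zero] at this
    refine this.congr fun t => ?_
    congr 2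
    ring

theorem continuous_argSum_add_real (s : Multiset ℝ) {u : ℂ} (hu : 0 < u.im) :
    Continuous fun t : ℝ => argSum s (u + t) := by
  induction s using Multiset.induction with
  | empty => simpa [argSum] using continuous_const
  | cons a s ih =>
    simp only [argSum_cons]
    refine Continuous.add ?_ ih
    rw [continuous_iff_continuousAt]
    intro t
    refine ContinuousAt.comp (f := fun t : ℝ => u + t - a) (Complex.continuousAt_arg ?_) ?_
    · rw [Complex.mem_slitPlane_iff]
      right
      simpa using hu.ne'
    · exact (by fun_prop : Continuous fun t : ℝ => u + t - (a : ℂ)).continuousAt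

open Filter Topology in
theorem tendsto_argSum_boundary (s : Multiset ℝ) {t : ℝ} (ht : t ∉ s) :
    Tendsto (fun ε : ℝ => argSum s (t + ε * Complex.I)) (𝓝[>] 0)
      (𝓝 (Real.pi * s.countP (t < ·))) := by
  induction s using Multiset.induction with
  | empty => simp [argSum]
  | cons a s ih =>
    simp only [argSum_cons]
    rw [Multiset.mem_cons, not_or] at ht
    have hpath : Tendsto (fun ε : ℝ => (t + ε * Complex.I - a : ℂ)) (𝓝[>] 0)
        (𝓝[{z : ℂ | 0 ≤ z.im}] ((t - a : ℝ) : ℂ)) := by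
      refine tendsto_nhdsWithin_iff.2 ⟨?_, ?_⟩
      · have : Continuous fun ε : ℝ => (t + ε * Complex.I - a : ℂ) := by fun_prop
        have := (this.tendsto 0).mono_left (nhdsWithin_le_nhds (s := Set.Ioi 0))
        simpa using this
      · filter_upwards [self_mem_nhdsWithin] with ε hε
        have : 0 < ε := hε
        simpa using this.le
    have harg : Tendsto (fun ε : ℝ => (t + ε * Complex.I - a : ℂ).arg) (𝓝[>] 0)
        (𝓝 (if t < a then Real.pi else 0)) := by
      split_ifs with hta
      · exact (Complex.tendsto_arg_nhdsWithin_im_nonneg_of_re_neg_of_im_zero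
          (by simpa using hta) (by simp)).comp hpath
      · have hat : a < t := lt_of_le_of_ne (not_lt.1 hta) (Ne.symm ht.1)
        have hc : ContinuousAt Complex.arg ((t - a : ℝ) : ℂ) := by
          refine Complex.continuousAt_arg ?_
          rw [Complex.mem_slitPlane_iff]
          left
          simpa using hat
        have := hc.tendsto.comp (hpath.mono_right nhdsWithin_le_nhds)
        rwa [Complex.arg_ofReal_of_nonneg (sub_nonneg.2 hat.le)] at this
    convert harg.add (ih ht.2) using 2
    rw [Multiset.countP_cons]
    split_ifs <;> push_cast <;> ring

theorem argSum_sub_mem_Icc {s r : Multiset ℝ}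
    (hsin : ∀ u : ℂ, 0 < u.im → 0 ≤ Real.sin (argSum s u - argSum r u)) {u : ℂ} (hu : 0 < u.im) :
    argSum s u - argSum r u ∈ Set.Icc 0 Real.pi := by
  set D : ℝ → ℝ := fun t => argSum s (u + t) - argSum r (u + t) with hD
  have hcont : Continuous D :=
    (continuous_argSum_add_real s hu).sub (continuous_argSum_add_real r hu)
  have hlim : Filter.Tendsto D Filter.atTop (nhds 0) := by
    simpa using (tendsto_argSum_add_real s u).sub (tendsto_argSum_add_real r u)
  have hsinD : ∀ t, 0 ≤ Real.sin (D t) := fun t => hsin _ (by simpa using hu)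
  have hpi := Real.pi_pos
  obtain ⟨T, hT0, hT1, hT2⟩ : ∃ T : ℝ, 0 ≤ T ∧ -(Real.pi / 2) < D T ∧ D T < Real.pi / 2 := by
    have := ((Filter.eventually_ge_atTop 0).and
      ((hlim.eventually (lt_mem_nhds (by linarith : -(Real.pi / 2) < 0))).and
      (hlim.eventually (gt_mem_nhds (by linarith : 0 < Real.pi / 2))))).exists
    exact this
  have hD0 : argSum s u - argSum r u = D 0 := by simp [hD]
  rw [hD0]
  have hbad : ∀ c, Real.sin c = -1 → c ∉ D '' Set.Icc 0 T := by
    rintro c hc ⟨t, -, rfl⟩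
    linarith [hsinD t]
  have hs1 : Real.sin (-(Real.pi / 2)) = -1 := by rw [Real.sin_neg, Real.sin_pi_div_two]
  have hs2 : Real.sin (Real.pi / 2 + Real.pi) = -1 := by
    rw [Real.sin_add_pi, Real.sin_pi_div_two]
  have hlo : -(Real.pi / 2) < D 0 := by
    by_contra h
    exact hbad _ hs1 (intermediate_value_Icc hT0 hcont.continuousOn ⟨not_lt.1 h, hT1.le⟩)
  have hhi : D 0 < Real.pi / 2 + Real.pi := by
    by_contra h
    exact hbad _ hs2 (intermediate_value_Icc' hT0 hcont.continuousOn ⟨by linarith, not_lt.1 h⟩)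
  constructor
  · by_contra h
    exact absurd (hsinD 0) (not_le.2 (Real.sin_neg_of_neg_of_neg_pi_lt (not_le.1 h) (by linarith)))
  · by_contra h
    have h1 : 0 < Real.sin (D 0 - Real.pi) :=
      Real.sin_pos_of_pos_of_lt_pi (by linarith [not_le.1 h]) (by linarith)
    rw [Real.sin_sub_pi] at h1
    linarith [hsinD 0]

theorem UnitRooted.realRooted {f : ℝ[X]} (hf : UnitRooted f) : RealRooted f :=
  ⟨hf.ne_zero, fun z hz => (hf z (by rwa [IsRoot, eval_map_algebraMap] at hz)).1⟩

theorem UnitRooted.splits {f : ℝ[X]} (hf : UnitRooted f) : f.Splits := by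
  refine Splits.of_splits_map (algebraMap ℝ ℂ) (IsAlgClosed.splits _) fun z hz => ?_
  have hz' := (mem_roots'.1 hz).2
  rw [IsRoot, eval_map_algebraMap] at hz'
  exact ⟨z.re, Complex.ext (by simp) (by simp [(hf z hz').1])⟩

theorem UnitRooted.aeval_eq_prod {f : ℝ[X]} (hf : UnitRooted f) (u : ℂ) :
    aeval u f = (f.leadingCoeff : ℂ) * (f.roots.map fun a : ℝ => u - a).prod := by
  conv_lhs => rw [hf.splits.eq_prod_roots]
  rw [map_mul, aeval_C, map_multiset_prod, Multiset.map_map]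
  simp

theorem StablePair.sin_argSum_nonneg {h f : ℝ[X]} (hs : StablePair h f) (hf : UnitRooted f)
    (hh : UnitRooted h) (hfl : 0 < f.leadingCoeff) (hhl : 0 < h.leadingCoeff) {u : ℂ}
    (hu : 0 < u.im) : 0 ≤ Real.sin (argSum f.roots u - argSum h.roots u) := by
  obtain ⟨r, hr, hr'⟩ := exists_prod_sub_eq_exp_argSum f.roots hu
  obtain ⟨q, hq, hq'⟩ := exists_prod_sub_eq_exp_argSum h.roots hu
  have hdiv : aeval u f / aeval u h = ((f.leadingCoeff * r / (h.leadingCoeff * q) : ℝ) : ℂ) *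
      Complex.exp (((argSum f.roots u - argSum h.roots u : ℝ) : ℂ) * Complex.I) := by
    rw [hf.aeval_eq_prod, hh.aeval_eq_prod, hr', hq', Complex.ofReal_sub, sub_mul, Complex.exp_sub]
    push_cast
    rw [← mul_assoc, ← mul_assoc, mul_div_mul_comm]
  have him : (aeval u f / aeval u h).im = f.leadingCoeff * r / (h.leadingCoeff * q) *
      Real.sin (argSum f.roots u - argSum h.roots u) := by
    rw [hdiv, Complex.im_ofReal_mul, Complex.exp_ofReal_mul_I_im]
  have hpos : 0 < f.leadingCoeff * r / (h.leadingCoeff * q) := by positivity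
  by_contra hneg
  refine hs u (-(aeval u f / aeval u h)) hu ?_ ?_
  · rw [Complex.neg_im, him]
    nlinarith [not_le.1 hneg]
  · rw [neg_mul, div_mul_cancel₀ _ (hh.aeval_ne_zero hu), add_neg_cancel]

theorem StablePair.countP_roots {h f : ℝ[X]} (hs : StablePair h f) (hf : UnitRooted f)
    (hh : UnitRooted h) (hfl : 0 < f.leadingCoeff) (hhl : 0 < h.leadingCoeff) {t : ℝ}
    (htf : t ∉ f.roots) (hth : t ∉ h.roots) :
    h.roots.countP (t < ·) ≤ f.roots.countP (t < ·) ∧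
      f.roots.countP (t < ·) ≤ h.roots.countP (t < ·) + 1 := by
  have hlim := (tendsto_argSum_boundary f.roots htf).sub (tendsto_argSum_boundary h.roots hth)
  have hmem := isClosed_Icc.mem_of_tendsto hlim (b := nhdsWithin 0 (Set.Ioi 0))
    (s := Set.Icc 0 Real.pi) (by
      filter_upwards [self_mem_nhdsWithin] with ε hε
      have : 0 < ε := hε
      exact argSum_sub_mem_Icc
        (fun u hu => hs.sin_argSum_nonneg hf hh hfl hhl hu) (by simpa using this))
  rw [← mul_sub] at hmem
  have hpi := Real.pi_pos
  constructor
  · have := nonneg_of_mul_nonneg_right hmem.1 hpi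
    exact_mod_cast sub_nonneg.1 this
  · have h2 : Real.pi * ((f.roots.countP (t < ·) : ℝ) - (h.roots.countP (t < ·) : ℝ)) ≤
        Real.pi * 1 := by simpa using hmem.2
    have := le_of_mul_le_mul_left h2 hpi
    have h3 : (f.roots.countP (t < ·) : ℝ) ≤ (h.roots.countP (t < ·) : ℝ) + 1 := by linarith
    exact_mod_cast h3

theorem StablePair.interlaces {h f : ℝ[X]} (hs : StablePair h f) (hf : UnitRooted f)
    (hh : UnitRooted h) (hfl : 0 < f.leadingCoeff) (hhl : 0 < h.leadingCoeff)
    (hdeg : f.natDegree = h.natDegree + 1) : Interlaces h f := by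
  refine ⟨hf.realRooted, hh.realRooted, hdeg, fun i hi => ?_⟩
  have hlen : ∀ p : ℝ[X], UnitRooted p → (sortedRoots p).length = p.natDegree := fun p hp => by
    rw [sortedRoots, Multiset.length_sort, splits_iff_card_roots.1 hp.splits]
  have hcount : ∀ (p : ℝ[X]) (t : ℝ), p.roots.countP (t < ·) = (sortedRoots p).countP (t < ·) :=
    fun p t => by
      conv_lhs => rw [← Multiset.sort_eq (s := p.roots) (r := (· ≤ ·))]
      rw [Multiset.coe_countP]
      rfl
  have hsort : ∀ p : ℝ[X], (sortedRoots p).Pairwise (· ≤ ·) := fun p => Multiset.pairwise_sort _ _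
  have hbetween : ∀ a b : ℝ, a < b → ∃ t, a < t ∧ t < b ∧ t ∉ f.roots ∧ t ∉ h.roots := by
    intro a b hab
    obtain ⟨t, ⟨h1, h2⟩, h3⟩ := ((Set.Ioo_infinite hab).sdiff
      ((f.roots.toFinset ∪ h.roots.toFinset).finite_toSet)).nonempty
    simp only [Finset.coe_union, Set.mem_union, Finset.mem_coe, Multiset.mem_toFinset,
      not_or] at h3
    exact ⟨t, h1, h2, h3.1, h3.2⟩
  have hlf := hlen f hf
  have hlh := hlen h hh
  constructor
  · by_contra hlt
    obtain ⟨t, h1, h2, h3, h4⟩ := hbetween _ _ (not_le.1 hlt)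
    have hc := (hs.countP_roots hf hh hfl hhl h3 h4).2
    rw [hcount, hcount] at hc
    have := (hsort f).length_sub_le_countP (by omega) h2
    have := (hsort h).countP_le_length_sub (by omega) h1
    omega
  · by_contra hlt
    obtain ⟨t, h1, h2, h3, h4⟩ := hbetween _ _ (not_le.1 hlt)
    have hc := (hs.countP_roots hf hh hfl hhl h3 h4).1
    rw [hcount, hcount] at hc
    have := (hsort h).length_sub_le_countP (by omega) h2
    have := (hsort f).countP_le_length_sub (by omega) h1
    omega

/-- A surjective partition onto an initial segment `{0, …, len - 1}` of `ℕ` which is weakly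
decreasing along `R` and strictly decreasing along `T`. -/
@[ext]
structure PackedWord {α : Type*} (R T : α → α → Prop) where
  word : α → ℕ
  len : ℕ
  range_eq : Set.range word = Set.Iio len
  weak : ∀ x y, R x y → word y ≤ word x
  strict : ∀ x y, T x y → word y < word x

namespace PackedWord

variable {α β : Type*} {R T : α → α → Prop} {R' T' : β → β → Prop}

theorem word_lt (p : PackedWord R T) (a : α) : p.word a < p.len :=
  p.range_eq.le ⟨a, rfl⟩

theorem exists_word_eq (p : PackedWord R T) {m : ℕ} (hm : m < p.len) : ∃ a, p.word a = m :=
  p.range_eq.ge hm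

theorem ext_word {p q : PackedWord R T} (h : p.word = q.word) : p = q :=
  PackedWord.ext h (Set.Iio_injective (by rw [← p.range_eq, ← q.range_eq, h]))

theorem len_le_card [Finite α] (p : PackedWord R T) : p.len ≤ Nat.card α := by
  have h : (Set.range p.word).ncard ≤ Nat.card α := by
    rw [← Set.image_univ, ← Set.ncard_univ]
    exact Set.ncard_image_le Set.finite_univ
  rwa [p.range_eq, ← Finset.coe_range, Set.ncard_coe_finset, Finset.card_range] at h

instance [Finite α] : Finite (PackedWord R T) :=
  Finite.of_injective
    (fun p : PackedWord R T => fun a => (⟨p.word a, (p.word_lt a).trans_le p.len_le_card⟩ :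
      Fin (Nat.card α))) fun _ _ h =>
    ext_word (funext fun a => congrArg Fin.val (congrFun h a))

noncomputable instance [Finite α] : Fintype (PackedWord R T) := Fintype.ofFinite _

theorem len_pos [Nonempty α] (p : PackedWord R T) : 0 < p.len :=
  (Nat.zero_le _).trans_lt (p.word_lt (Classical.arbitrary α))

end PackedWord

/-- The generating polynomial of packed words by the size of their image. -/
noncomputable def packedPoly {α : Type*} [Finite α] (R T : α → α → Prop) : ℝ[X] :=
  ∑ p : PackedWord R T, X ^ p.len

section Combinatorics

variable {α β : Type*} {R T : α → α → Prop} {R' T' : β → β → Prop}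

theorem packedPoly_congr [Finite α] [Finite β] (e : α ≃ β) (hR : ∀ x y, R x y ↔ R' (e x) (e y))
    (hT : ∀ x y, T x y ↔ T' (e x) (e y)) : packedPoly R T = packedPoly R' T' := by
  let F : PackedWord R' T' → PackedWord R T := fun p =>
    { word := p.word ∘ e
      len := p.len
      range_eq := by rw [e.surjective.range_comp, p.range_eq]
      weak := fun x y h => p.weak _ _ ((hR x y).1 h)
      strict := fun x y h => p.strict _ _ ((hT x y).1 h) }
  have hF : Function.Bijective F := by
    refine ⟨fun p q h => PackedWord.ext_word ?_, fun p => ?_⟩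
    · have : p.word ∘ e = q.word ∘ e := congrArg PackedWord.word h
      exact e.surjective.injective_comp_right this
    · refine ⟨⟨p.word ∘ e.symm, p.len, ?_, fun x y h => ?_, fun x y h => ?_⟩, ?_⟩
      · rw [e.symm.surjective.range_comp, p.range_eq]
      · exact p.weak _ _ ((hR _ _).2 (by simpa using h))
      · exact p.strict _ _ ((hT _ _).2 (by simpa using h))
      · exact PackedWord.ext_word (funext fun a => by simp [F])
  exact (hF.sum_comp (fun p : PackedWord R T => (X : ℝ[X]) ^ p.len)).symm

theorem packedPoly_of_isEmpty [IsEmpty α] : packedPoly R T = 1 := by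
  have : Unique (PackedWord R T) :=
    { default := ⟨isEmptyElim, 0, by simp [Set.range_eq_empty], fun x => isEmptyElim x,
        fun x => isEmptyElim x⟩
      uniq := fun p => PackedWord.ext_word (funext fun a => isEmptyElim a) }
  have hlen : ∀ p : PackedWord R T, p.len = 0 := fun p => by
    have := p.len_le_card
    simpa using this
  simp [packedPoly, hlen]

theorem range_sum_elim_add {f : α → ℕ} {g : β → ℕ} {k l s : ℕ} (hf : Set.range f = Set.Iio k)
    (hg : Set.range g = Set.Iio l) (hs : s ≤ l) (hl : l ≤ s + k) :
    Set.range (Sum.elim (fun a => s + f a) g) = Set.Iio (s + k) := by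
  ext m
  simp only [Set.mem_range, Sum.exists, Sum.elim_inl, Sum.elim_inr, Set.mem_Iio]
  constructor
  · rintro (⟨a, rfl⟩ | ⟨b, rfl⟩)
    · have : f a < k := hf.le ⟨a, rfl⟩
      omega
    · have : g b < l := hg.le ⟨b, rfl⟩
      omega
  · intro hm
    by_cases h : m < l
    · exact Or.inr (hg.ge h)
    · obtain ⟨a, ha⟩ := hf.ge (show m - s < k by omega)
      exact Or.inl ⟨a, by omega⟩

theorem exists_range_eq_Iio [Finite α] {f : α → ℕ} (hf : ∀ a, ∀ m < f a, ∃ b, f b = m) :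
    ∃ k, Set.range f = Set.Iio k := by
  classical
  have hex : ∃ k, k ∉ Set.range f := (Set.finite_range f).exists_notMem
  refine ⟨Nat.find hex, Set.ext fun m => ⟨?_, fun hm => ?_⟩⟩
  · rintro ⟨a, rfl⟩
    by_contra h
    rcases eq_or_lt_of_le (Set.notMem_Iio.1 h) with h | h
    · exact Nat.find_spec hex ⟨a, h.symm⟩
    · exact Nat.find_spec hex (hf a _ h)
  · by_contra h
    exact Nat.find_min hex hm h

theorem range_sub_inl {σ : α ⊕ β → ℕ} {n l s : ℕ} (hσ : Set.range σ = Set.Iio n)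
    (hl : Set.range (σ ∘ Sum.inr) = Set.Iio l) (hs : ∀ a, s ≤ σ (Sum.inl a))
    (h : ∀ m, s ≤ m → m < l → ∃ a, σ (Sum.inl a) = m) :
    Set.range (fun a => σ (Sum.inl a) - s) = Set.Iio (n - s) := by
  ext m
  simp only [Set.mem_range, Set.mem_Iio]
  constructor
  · rintro ⟨a, rfl⟩
    have : σ (Sum.inl a) < n := hσ.le ⟨_, rfl⟩
    have := hs a
    omega
  · intro hm
    by_cases hml : m + s < l
    · obtain ⟨a, ha⟩ := h (m + s) (by omega) hml
      exact ⟨a, by omega⟩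
    · obtain ⟨x, hx⟩ := hσ.ge (show m + s < n by omega)
      cases x with
      | inl a => exact ⟨a, by omega⟩
      | inr b =>
        have : (σ ∘ Sum.inr) b < l := hl.le ⟨b, rfl⟩
        rw [Function.comp_apply, hx] at this
        omega

theorem PackedWord.exists_range_inr [Finite β] {T₀ : α ⊕ β → α ⊕ β → Prop}
    (p : PackedWord (Sum.Lex R R') T₀) :
    ∃ l, Set.range (p.word ∘ Sum.inr) = Set.Iio l := by
  refine exists_range_eq_Iio fun b m hm => ?_
  obtain ⟨x, hx⟩ := p.exists_word_eq ((show m < p.word (Sum.inr b) from hm).trans (p.word_lt _))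
  cases x with
  | inl a =>
    have := p.weak _ _ (Sum.Lex.sep a b)
    simp only [Function.comp_apply] at hm
    omega
  | inr b' => exact ⟨b', hx⟩

theorem packedPoly_lex_lex [Finite α] [Finite β] :
    packedPoly (Sum.Lex R R') (Sum.Lex T T') = packedPoly R T * packedPoly R' T' := by
  let F : PackedWord R T × PackedWord R' T' → PackedWord (Sum.Lex R R') (Sum.Lex T T') := fun p =>
    { word := Sum.elim (fun a => p.2.len + p.1.word a) p.2.word
      len := p.2.len + p.1.len
      range_eq := range_sum_elim_add p.1.range_eq p.2.range_eq le_rfl (by omega)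
      weak := by
        rintro _ _ (h | h | ⟨a, b⟩)
        · simpa using p.1.weak _ _ h
        · simpa using p.2.weak _ _ h
        · have := p.2.word_lt b
          simp only [Sum.elim_inl, Sum.elim_inr]
          omega
      strict := by
        rintro _ _ (h | h | ⟨a, b⟩)
        · simpa using p.1.strict _ _ h
        · simpa using p.2.strict _ _ h
        · have := p.2.word_lt b
          simp only [Sum.elim_inl, Sum.elim_inr]
          omega }
  have hF : Function.Bijective F := by
    constructor
    · rintro ⟨p, q⟩ ⟨p', q'⟩ h
      have hw : ∀ x, (F (p, q)).word x = (F (p', q')).word x := fun x => by rw [h]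
      have hq : q = q' := PackedWord.ext_word (funext fun b => hw (Sum.inr b))
      subst hq
      have hp : p = p' := PackedWord.ext_word (funext fun a => by simpa [F] using hw (Sum.inl a))
      rw [hp]
    · intro p
      obtain ⟨l, hl⟩ := p.exists_range_inr
      have hs : ∀ a, l ≤ p.word (Sum.inl a) := by
        intro a
        by_contra h
        obtain ⟨b, hb⟩ := hl.ge (not_le.1 h)
        have := p.strict _ _ (Sum.Lex.sep a b)
        simp only [Function.comp_apply] at hb
        omega
      refine ⟨(⟨_, _, range_sub_inl p.range_eq hl hs (by omega), fun x y h => ?_, fun x y h => ?_⟩,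
        ⟨_, _, hl, fun x y h => p.weak _ _ (Sum.Lex.inr h),
          fun x y h => p.strict _ _ (Sum.Lex.inr h)⟩), ?_⟩
      · exact Nat.sub_le_sub_right (p.weak _ _ (Sum.Lex.inl h)) l
      · have := p.strict _ _ (Sum.Lex.inl h : Sum.Lex T T' _ _)
        have := hs y
        omega
      · refine PackedWord.ext_word (funext fun x => ?_)
        cases x with
        | inl a => exact Nat.add_sub_cancel' (hs a)
        | inr b => rfl
  rw [packedPoly, packedPoly, packedPoly, Fintype.sum_mul_sum, ← Fintype.sum_prod_type',
    ← hF.sum_comp]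
  exact Finset.sum_congr rfl fun p _ => by rw [← pow_add, add_comm]

theorem X_mul_packedPoly_lex_liftRel [Finite α] [Finite β] [Nonempty α] [Nonempty β] :
    X * packedPoly (Sum.Lex R R') (Sum.LiftRel T T') =
      (X + 1) * (packedPoly R T * packedPoly R' T') := by
  let sh : Bool → PackedWord R' T' → ℕ := fun ε q => if ε then q.len else q.len - 1
  have hsh1 : ∀ ε q, sh ε q ≤ q.len := fun ε q => by cases ε <;> simp [sh]
  have hsh2 : ∀ ε q, q.len ≤ sh ε q + 1 := fun ε q => by
    cases ε
    · simp only [sh, Bool.false_eq_true, if_false]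
      omega
    · simp [sh]
  let F : Bool × PackedWord R T × PackedWord R' T' →
      PackedWord (Sum.Lex R R') (Sum.LiftRel T T') := fun p =>
    { word := Sum.elim (fun a => sh p.1 p.2.2 + p.2.1.word a) p.2.2.word
      len := sh p.1 p.2.2 + p.2.1.len
      range_eq := range_sum_elim_add p.2.1.range_eq p.2.2.range_eq (hsh1 _ _) (by
        have := hsh2 p.1 p.2.2
        have := p.2.1.len_pos
        omega)
      weak := by
        rintro _ _ (h | h | ⟨a, b⟩)
        · simpa using p.2.1.weak _ _ h
        · simpa using p.2.2.weak _ _ h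
        · have := p.2.2.word_lt b
          have := hsh2 p.1 p.2.2
          simp only [Sum.elim_inl, Sum.elim_inr]
          omega
      strict := by
        rintro _ _ (h | h)
        · simpa using p.2.1.strict _ _ h
        · simpa using p.2.2.strict _ _ h }
  have hF : Function.Bijective F := by
    constructor
    · rintro ⟨ε, p, q⟩ ⟨ε', p', q'⟩ h
      have hw : ∀ x, (F (ε, p, q)).word x = (F (ε', p', q')).word x := fun x => by rw [h]
      have hq : q = q' := PackedWord.ext_word (funext fun b => hw (Sum.inr b))
      subst hq
      have hadd : ∀ a, sh ε q + p.word a = sh ε' q + p'.word a := fun a => hw (Sum.inl a)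
      have hsh : sh ε q = sh ε' q := by
        obtain ⟨a, ha⟩ := p.exists_word_eq p.len_pos
        obtain ⟨a', ha'⟩ := p'.exists_word_eq p'.len_pos
        have := hadd a
        have := hadd a'
        omega
      have hε : ε = ε' := by
        have := q.len_pos
        cases ε <;> cases ε' <;> simp [sh] at hsh ⊢ <;> omega
      have hp : p = p' := PackedWord.ext_word (funext fun a => by
        have := hadd a
        omega)
      rw [hε, hp]
    · intro p
      obtain ⟨l, hl⟩ := p.exists_range_inr
      obtain ⟨ε, hs, hcover⟩ : ∃ ε : Bool,
          (∀ a, (if ε then l else l - 1) ≤ p.word (Sum.inl a)) ∧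
          ∀ m, (if ε then l else l - 1) ≤ m → m < l → ∃ a, p.word (Sum.inl a) = m := by
        have hweak : ∀ a, l - 1 ≤ p.word (Sum.inl a) := by
          intro a
          rcases Nat.eq_zero_or_pos l with h0 | h0
          · omega
          · obtain ⟨b, hb⟩ := hl.ge (show l - 1 < l by omega)
            have := p.weak _ _ (Sum.Lex.sep a b)
            simp only [Function.comp_apply] at hb
            omega
        by_cases hshared : ∃ a, p.word (Sum.inl a) < l
        · obtain ⟨a, ha⟩ := hshared
          refine ⟨false, by simpa using hweak, fun m hm hml => ⟨a, ?_⟩⟩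
          have := hweak a
          simp only [Bool.false_eq_true, if_false] at hm
          omega
        · push Not at hshared
          refine ⟨true, by simpa using hshared, fun m hm hml => ?_⟩
          simp only [if_true] at hm
          omega
      let q : PackedWord R' T' := ⟨_, _, hl, fun x y h => p.weak _ _ (Sum.Lex.inr h),
          fun x y h => p.strict _ _ (Sum.LiftRel.inr h)⟩
      refine ⟨(ε, ⟨_, _, range_sub_inl p.range_eq hl hs hcover, fun x y h => ?_,
        fun x y h => ?_⟩, q), ?_⟩
      · exact Nat.sub_le_sub_right (p.weak _ _ (Sum.Lex.inl h)) _
      · have := p.strict _ _ (Sum.LiftRel.inl h : Sum.LiftRel T T' _ _)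
        have := hs y
        omega
      · refine PackedWord.ext_word (funext fun x => ?_)
        cases x with
        | inl a => exact Nat.add_sub_cancel' (hs a)
        | inr b => rfl
  rw [packedPoly, packedPoly, packedPoly, Fintype.sum_mul_sum, ← Fintype.sum_prod_type',
    ← hF.sum_comp, Fintype.sum_prod_type, Fintype.sum_bool, ← Finset.sum_add_distrib,
    Finset.mul_sum, Finset.mul_sum]
  refine Finset.sum_congr rfl fun p _ => ?_
  obtain ⟨l, hl⟩ := Nat.exists_eq_succ_of_ne_zero p.2.len_pos.ne'
  simp only [F, sh, if_true, Bool.false_eq_true, if_false, hl, Nat.succ_eq_add_one,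
    Nat.add_sub_cancel]
  ring

end Combinatorics

section BoundedWords

variable {α β : Type*} {R T : α → α → Prop} {R' T' : β → β → Prop}

/-- Maps to `Fin n` that are weakly decreasing along `R` and strictly decreasing along `T`. -/
def BoundedWord {α : Type*} (n : ℕ) (R T : α → α → Prop) : Type _ :=
  {σ : α → Fin n // (∀ x y, R x y → σ y ≤ σ x) ∧ ∀ x y, T x y → σ y < σ x}

/-- Spread a packed word over a set of letters of the right size. -/
def PackedWord.spread {n : ℕ} (p : PackedWord R T) (S : {S : Finset (Fin n) // S.card = p.len}) :
    BoundedWord n R T :=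
  ⟨fun a => S.1.orderEmbOfFin S.2 ⟨p.word a, p.word_lt a⟩,
    fun x y h => by simpa using p.weak x y h, fun x y h => by simpa using p.strict x y h⟩

theorem PackedWord.range_spread {n : ℕ} (p : PackedWord R T)
    (S : {S : Finset (Fin n) // S.card = p.len}) : Set.range (p.spread S).1 = S.1 := by
  rw [← Finset.range_orderEmbOfFin S.1 S.2]
  refine Set.Subset.antisymm ?_ ?_
  · rintro _ ⟨a, rfl⟩
    exact ⟨_, rfl⟩
  · rintro _ ⟨i, rfl⟩
    obtain ⟨a, ha⟩ := p.exists_word_eq i.2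
    exact ⟨a, congrArg _ (Fin.ext ha)⟩

theorem bijective_spread [Finite α] (n : ℕ) : Function.Bijective
    fun x : (p : PackedWord R T) × {S : Finset (Fin n) // S.card = p.len} => x.1.spread x.2 := by
  constructor
  · rintro ⟨p, S⟩ ⟨q, S'⟩ h
    have hS : S.1 = S'.1 := by
      have hr : Set.range (p.spread S).1 = Set.range (q.spread S').1 := congrArg
        (fun σ : BoundedWord n R T => Set.range σ.1) h
      rw [p.range_spread, q.range_spread] at hr
      exact Finset.coe_injective hr
    obtain ⟨S, hSp⟩ := S
    obtain ⟨S', hSq⟩ := S'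
    obtain rfl : S = S' := hS
    have hpq : p = q := by
      obtain ⟨w, k, hk, hkw, hks⟩ := p
      obtain ⟨w', k', hk', hkw', hks'⟩ := q
      obtain rfl : k = k' := hSp.symm.trans hSq
      refine PackedWord.ext_word (funext fun a => ?_)
      have ha := congrFun (congrArg Subtype.val h) a
      exact congrArg Fin.val ((S.orderEmbOfFin hSp).injective ha)
    subst hpq
    rfl
  · classical
    rintro ⟨σ, hw, hs⟩
    have := Fintype.ofFinite α
    let S : Finset (Fin n) := Finset.univ.image σ
    have hmem : ∀ a, σ a ∈ S := fun a => Finset.mem_image_of_mem _ (Finset.mem_univ a)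
    let e := S.orderIsoOfFin rfl
    refine ⟨⟨⟨fun a => e.symm ⟨σ a, hmem a⟩, S.card, ?_, fun x y h => ?_, fun x y h => ?_⟩, S, rfl⟩,
      ?_⟩
    · ext m
      constructor
      · rintro ⟨a, rfl⟩
        exact (e.symm _).2
      · intro hm
        obtain ⟨a, -, ha⟩ := Finset.mem_image.1 (e ⟨m, hm⟩).2
        refine ⟨a, ?_⟩
        have : (⟨σ a, hmem a⟩ : S) = e ⟨m, hm⟩ := Subtype.ext ha
        simp [this]
    · exact e.symm.monotone (hw x y h)
    · exact e.symm.strictMono (hs x y h)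
    · refine Subtype.ext (funext fun a => ?_)
      exact congrArg Subtype.val (e.apply_symm_apply ⟨σ a, hmem a⟩)

theorem binomEval_sum {ι : Type*} (n : ℕ) (s : Finset ι) (f : ι → ℝ[X]) :
    binomEval n (∑ i ∈ s, f i) = ∑ i ∈ s, binomEval n (f i) := by
  simp only [binomEval, finsetSum_coeff, Finset.sum_mul]
  exact Finset.sum_comm

theorem binomEval_X_pow (n k : ℕ) : binomEval n (X ^ k) = n.choose k := by
  simp only [binomEval, coeff_X_pow, ite_mul, one_mul, zero_mul, Finset.sum_ite_eq',
    Finset.mem_range]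
  split_ifs with h
  · rfl
  · rw [Nat.choose_eq_zero_of_lt (by omega), Nat.cast_zero]

theorem binomEval_packedPoly [Finite α] (n : ℕ) :
    binomEval n (packedPoly R T) = Nat.card (BoundedWord n R T) := by
  rw [packedPoly, binomEval_sum, ← Nat.card_eq_of_bijective _ (bijective_spread n), Nat.card_sigma,
    Nat.cast_sum]
  refine Finset.sum_congr rfl fun p _ => ?_
  rw [binomEval_X_pow, Nat.card_eq_fintype_card, Fintype.card_finset_len, Fintype.card_fin]

theorem card_boundedWord_liftRel (n : ℕ) :
    Nat.card (BoundedWord n (Sum.LiftRel R R') (Sum.LiftRel T T')) =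
      Nat.card (BoundedWord n R T) * Nat.card (BoundedWord n R' T') := by
  rw [← Nat.card_prod]
  refine Nat.card_congr
    { toFun := fun σ => (⟨σ.1 ∘ Sum.inl, fun x y h => σ.2.1 _ _ (Sum.LiftRel.inl h),
        fun x y h => σ.2.2 _ _ (Sum.LiftRel.inl h)⟩, ⟨σ.1 ∘ Sum.inr,
        fun x y h => σ.2.1 _ _ (Sum.LiftRel.inr h), fun x y h => σ.2.2 _ _ (Sum.LiftRel.inr h)⟩)
      invFun := fun σ => ⟨Sum.elim σ.1.1 σ.2.1, ?_, ?_⟩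
      left_inv := fun σ => Subtype.ext (Sum.elim_comp_inl_inr σ.1)
      right_inv := fun σ => rfl }
  · rintro _ _ (h | h)
    · exact σ.1.2.1 _ _ h
    · exact σ.2.2.1 _ _ h
  · rintro _ _ (h | h)
    · exact σ.1.2.2 _ _ h
    · exact σ.2.2.2 _ _ h

theorem packedPoly_liftRel [Finite α] [Finite β] :
    packedPoly (Sum.LiftRel R R') (Sum.LiftRel T T') =
      diamond ((packedPoly R' T').natDegree + 1) (packedPoly R T) (packedPoly R' T') := by
  refine binomEval_injective fun n => ?_
  rw [binomEval_diamond _ _ _ _ (Nat.lt_succ_self _), binomEval_packedPoly, binomEval_packedPoly,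
    binomEval_packedPoly, card_boundedWord_liftRel, Nat.cast_mul]

end BoundedWords

section Degree

variable {α : Type*} {R T : α → α → Prop}

theorem natDegree_packedPoly_le [Finite α] : (packedPoly R T).natDegree ≤ Nat.card α :=
  natDegree_sum_le_of_forall_le _ _ fun p _ => (natDegree_X_pow_le _).trans p.len_le_card

theorem coeff_packedPoly [Finite α] (k : ℕ) :
    (packedPoly R T).coeff k = Nat.card {p : PackedWord R T // p.len = k} := by
  classical
  simp only [packedPoly, finsetSum_coeff, coeff_X_pow]
  rw [Finset.sum_boole, Nat.card_eq_fintype_card, Fintype.card_subtype]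
  simp only [eq_comm]

theorem coeff_zero_packedPoly [Finite α] [Nonempty α] : (packedPoly R T).coeff 0 = 0 := by
  rw [coeff_packedPoly, Nat.cast_eq_zero, Nat.card_eq_zero]
  exact Or.inl ⟨fun p => p.1.len_pos.ne' p.2⟩

theorem coeff_card_packedPoly_pos [Finite α] [PartialOrder α] (hR : ∀ x y, R x y → x ≤ y)
    (hT : ∀ x y, T x y → x < y) : 0 < (packedPoly R T).coeff (Nat.card α) := by
  rw [coeff_packedPoly, Nat.cast_pos]
  have : Nonempty {p : PackedWord R T // p.len = Nat.card α} := by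
    have := Fintype.ofFinite α
    have : Fintype (LinearExtension α) := Fintype.ofFinite α
    let e : LinearExtension α ≃o Fin (Nat.card α) := (Fintype.orderIsoFinOfCardEq _
      (Nat.card_eq_fintype_card (α := LinearExtension α)).symm).symm
    let f : α → Fin (Nat.card α) := fun a => (e (toLinearExtension a)).rev
    have hf : Function.Bijective f :=
      (Fin.rev_bijective.comp e.bijective).comp Function.bijective_id
    have hanti : ∀ x y, x ≤ y → f y ≤ f x := fun x y h =>
      Fin.rev_le_rev.2 (e.monotone (toLinearExtension.monotone h))
    refine ⟨⟨fun a => f a, Nat.card α, ?_, fun x y h => hanti x y (hR x y h), fun x y h => ?_⟩, rfl⟩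
    · ext m
      constructor
      · rintro ⟨a, rfl⟩
        exact (f a).2
      · intro hm
        obtain ⟨a, ha⟩ := hf.2 ⟨m, hm⟩
        exact ⟨a, congrArg Fin.val ha⟩
    · exact lt_of_le_of_ne (hanti x y (hT x y h).le) fun h' =>
        (hT x y h).ne' (hf.1 (Fin.ext h'))
  exact Nat.card_pos

end Degree

/-- The pairs along which a `(P, ω)`-partition has to decrease strictly. -/
def StrictDescent {α : Type*} [PartialOrder α] (ω : α → ℕ) (x y : α) : Prop :=
  x < y ∧ ω y < ω x

section Epoly

variable {α : Type*} [PartialOrder α] [Finite α] (ω : α → ℕ)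

theorem Epoly_eq_packedPoly : Epoly α ω = packedPoly (· ≤ ·) (StrictDescent ω) := by
  ext k
  rw [Epoly, finsetSum_coeff]
  simp only [coeff_C_mul, coeff_X_pow, mul_ite, mul_one, mul_zero]
  rw [Finset.sum_ite_eq]
  split_ifs with h
  · rw [coeff_packedPoly, Nat.cast_inj]
    refine Nat.card_congr
      { toFun := fun σ => ⟨⟨fun a => σ.1 a, k, ?_, fun x y h => σ.2.2.1 x y h,
          fun x y h => σ.2.2.2 x y h.1 h.2⟩, rfl⟩
        invFun := fun p => ⟨fun a => ⟨p.1.word a, (p.1.word_lt a).trans_eq p.2⟩, fun m => ?_,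
          fun x y h => p.1.weak x y h, fun x y h h' => p.1.strict x y ⟨h, h'⟩⟩
        left_inv := fun σ => rfl
        right_inv := fun p => Subtype.ext (PackedWord.ext_word rfl) }
    · ext m
      constructor
      · rintro ⟨a, rfl⟩
        exact (σ.1 a).2
      · intro hm
        obtain ⟨a, ha⟩ := σ.2.1 ⟨m, hm⟩
        exact ⟨a, congrArg Fin.val ha⟩
    · obtain ⟨a, ha⟩ := p.1.exists_word_eq (m.2.trans_eq p.2.symm)
      exact ⟨a, Fin.ext ha⟩
  · refine (coeff_eq_zero_of_natDegree_lt (natDegree_packedPoly_le.trans_lt ?_)).symm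
    simpa using h

theorem natDegree_Epoly : (Epoly α ω).natDegree = Nat.card α := by
  rw [Epoly_eq_packedPoly]
  exact le_antisymm natDegree_packedPoly_le (le_natDegree_of_ne_zero
    (coeff_card_packedPoly_pos (fun _ _ => id) fun _ _ h => h.1).ne')

theorem leadingCoeff_Epoly_pos : 0 < (Epoly α ω).leadingCoeff := by
  rw [leadingCoeff, natDegree_Epoly, Epoly_eq_packedPoly]
  exact coeff_card_packedPoly_pos (fun _ _ => id) fun _ _ h => h.1

end Epoly

section Invariant

variable {α β : Type*} {R T : α → α → Prop} {R' T' : β → β → Prop}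

/-- The restriction of a relation to the complement of a point. -/
def eraseRel {α : Type*} (R : α → α → Prop) (x : α) (a b : {y // y ≠ x}) : Prop :=
  R a b

/-- The property of the packed polynomial that is preserved by all series-parallel operations. -/
structure ErasureStable [Finite α] (R T : α → α → Prop) : Prop where
  unitRooted : UnitRooted (packedPoly R T)
  unitRooted_erase : ∀ x, UnitRooted (packedPoly (eraseRel R x) (eraseRel T x))
  stablePair : ∀ x, StablePair (packedPoly (eraseRel R x) (eraseRel T x)) (packedPoly R T)

theorem ErasureStable.congr [Finite α] [Finite β] (h : ErasureStable R T) (e : α ≃ β)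
    (hR : ∀ x y, R x y ↔ R' (e x) (e y)) (hT : ∀ x y, T x y ↔ T' (e x) (e y)) :
    ErasureStable R' T' := by
  have herase : ∀ x, packedPoly (eraseRel R' x) (eraseRel T' x) =
      packedPoly (eraseRel R (e.symm x)) (eraseRel T (e.symm x)) := fun x =>
    (packedPoly_congr (e.subtypeEquiv fun a => e.eq_symm_apply.not)
      (fun _ _ => hR _ _) (fun _ _ => hT _ _)).symm
  refine ⟨?_, fun x => ?_, fun x => ?_⟩
  · exact packedPoly_congr e hR hT ▸ h.unitRooted
  · exact herase x ▸ h.unitRooted_erase _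
  · rw [herase, ← packedPoly_congr e hR hT]
    exact h.stablePair _

/-- Removing a point of the left summand. -/
noncomputable def sumEraseInl (x : α) : {a // a ≠ x} ⊕ β ≃ {y : α ⊕ β // y ≠ Sum.inl x} :=
  Equiv.ofBijective
    (Sum.elim (fun a => ⟨Sum.inl a, Sum.inl_injective.ne a.2⟩) fun b => ⟨Sum.inr b, Sum.inr_ne_inl⟩)
    ⟨by rintro (a | b) (a' | b') h <;> simp_all [Subtype.ext_iff], by
      rintro ⟨a | b, h⟩
      · exact ⟨Sum.inl ⟨a, fun h' => h (congrArg _ h')⟩, rfl⟩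
      · exact ⟨Sum.inr b, rfl⟩⟩

/-- Removing a point of the right summand. -/
noncomputable def sumEraseInr (x : β) : α ⊕ {b // b ≠ x} ≃ {y : α ⊕ β // y ≠ Sum.inr x} :=
  Equiv.ofBijective
    (Sum.elim (fun a => ⟨Sum.inl a, Sum.inl_ne_inr⟩) fun b => ⟨Sum.inr b, Sum.inr_injective.ne b.2⟩)
    ⟨by rintro (a | b) (a' | b') h <;> simp_all [Subtype.ext_iff], by
      rintro ⟨a | b, h⟩
      · exact ⟨Sum.inl a, rfl⟩
      · exact ⟨Sum.inr ⟨b, fun h' => h (congrArg _ h')⟩, rfl⟩⟩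

theorem coe_sumEraseInl (x : α) (a : {a // a ≠ x} ⊕ β) :
    (sumEraseInl x a : α ⊕ β) = Sum.map Subtype.val id a := by
  cases a <;> rfl

theorem coe_sumEraseInr (x : β) (a : α ⊕ {b // b ≠ x}) :
    (sumEraseInr x a : α ⊕ β) = Sum.map id Subtype.val a := by
  cases a <;> rfl

theorem lex_erase_inl_iff (x : α) (a b : {a // a ≠ x} ⊕ β) :
    Sum.Lex (eraseRel R x) R' a b ↔
      eraseRel (Sum.Lex R R') (Sum.inl x) (sumEraseInl x a) (sumEraseInl x b) := by
  rcases a with a | a <;> rcases b with b | b <;> simp [coe_sumEraseInl, eraseRel]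

theorem lex_erase_inr_iff (x : β) (a b : α ⊕ {b // b ≠ x}) :
    Sum.Lex R (eraseRel R' x) a b ↔
      eraseRel (Sum.Lex R R') (Sum.inr x) (sumEraseInr x a) (sumEraseInr x b) := by
  rcases a with a | a <;> rcases b with b | b <;> simp [coe_sumEraseInr, eraseRel]

theorem liftRel_erase_inl_iff (x : α) (a b : {a // a ≠ x} ⊕ β) :
    Sum.LiftRel (eraseRel R x) R' a b ↔
      eraseRel (Sum.LiftRel R R') (Sum.inl x) (sumEraseInl x a) (sumEraseInl x b) := by
  rcases a with a | a <;> rcases b with b | b <;> simp [coe_sumEraseInl, eraseRel]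

theorem liftRel_erase_inr_iff (x : β) (a b : α ⊕ {b // b ≠ x}) :
    Sum.LiftRel R (eraseRel R' x) a b ↔
      eraseRel (Sum.LiftRel R R') (Sum.inr x) (sumEraseInr x a) (sumEraseInr x b) := by
  rcases a with a | a <;> rcases b with b | b <;> simp [coe_sumEraseInr, eraseRel]

theorem ErasureStable.of_sum [Finite α] [Finite β] {R T : α ⊕ β → α ⊕ β → Prop}
    {Rl Tl : (x : α) → {a // a ≠ x} ⊕ β → {a // a ≠ x} ⊕ β → Prop}
    {Rr Tr : (x : β) → α ⊕ {b // b ≠ x} → α ⊕ {b // b ≠ x} → Prop}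
    (hRl : ∀ x a b, Rl x a b ↔ eraseRel R (Sum.inl x) (sumEraseInl x a) (sumEraseInl x b))
    (hTl : ∀ x a b, Tl x a b ↔ eraseRel T (Sum.inl x) (sumEraseInl x a) (sumEraseInl x b))
    (hRr : ∀ x a b, Rr x a b ↔ eraseRel R (Sum.inr x) (sumEraseInr x a) (sumEraseInr x b))
    (hTr : ∀ x a b, Tr x a b ↔ eraseRel T (Sum.inr x) (sumEraseInr x a) (sumEraseInr x b))
    (h : UnitRooted (packedPoly R T))
    (hl : ∀ x, UnitRooted (packedPoly (Rl x) (Tl x)) ∧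
      StablePair (packedPoly (Rl x) (Tl x)) (packedPoly R T))
    (hr : ∀ x, UnitRooted (packedPoly (Rr x) (Tr x)) ∧
      StablePair (packedPoly (Rr x) (Tr x)) (packedPoly R T)) : ErasureStable R T := by
  have key : ∀ x, UnitRooted (packedPoly (eraseRel R x) (eraseRel T x)) ∧
      StablePair (packedPoly (eraseRel R x) (eraseRel T x)) (packedPoly R T) := by
    rintro (x | x)
    · rw [← packedPoly_congr (sumEraseInl x) (hRl x) (hTl x)]
      exact hl x
    · rw [← packedPoly_congr (sumEraseInr x) (hRr x) (hTr x)]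
      exact hr x
  exact ⟨h, fun x => (key x).1, fun x => (key x).2⟩

theorem UnitRooted.mul {f g : ℝ[X]} (hf : UnitRooted f) (hg : UnitRooted g) :
    UnitRooted (f * g) := by
  intro z hz
  rw [map_mul, mul_eq_zero] at hz
  exact hz.elim (hf z) (hg z)

theorem StablePair.mul_right {f g h : ℝ[X]} (hs : StablePair h f) (hg : UnitRooted g) :
    StablePair (h * g) (f * g) := by
  intro u y hu hy
  rw [map_mul, map_mul, ← mul_assoc, ← add_mul]
  exact mul_ne_zero (hs u y hu hy) fun h => hu.ne' (hg u h).1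

theorem StablePair.mul_left {f g h : ℝ[X]} (hs : StablePair h f) (hg : UnitRooted g) :
    StablePair (g * h) (g * f) := by
  rw [mul_comm g, mul_comm g]
  exact hs.mul_right hg

theorem UnitRooted.of_X_mul_eq {f g F : ℝ[X]} (hf : UnitRooted f) (hg : UnitRooted g)
    (hF : X * F = (X + 1) * (f * g)) : UnitRooted F := by
  intro z hz
  have h := congrArg (aeval z) hF
  simp only [map_mul, map_add, aeval_X, map_one, hz, mul_zero] at h
  rcases mul_eq_zero.1 h.symm with h | h
  · rw [eq_neg_of_add_eq_zero_left h]
    simp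
  · exact hf.mul hg z (by rw [map_mul, h])

theorem StablePair.of_X_mul_eq {f g h F H : ℝ[X]} (hs : StablePair h f) (hg : UnitRooted g)
    (hF : X * F = (X + 1) * (f * g)) (hH : X * H = (X + 1) * (h * g)) : StablePair H F := by
  intro u y hu hy h0
  have h1 := congrArg (aeval u) hF
  have h2 := congrArg (aeval u) hH
  simp only [map_mul, map_add, aeval_X, map_one] at h1 h2
  have h3 : (u + 1) * (aeval u f + y * aeval u h) * aeval u g = 0 := by
    linear_combination u * h0 - h1 - y * h2
  have hu1 : u + 1 ≠ 0 := fun h => hu.ne' (by simpa using congrArg Complex.im h)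
  exact mul_ne_zero (mul_ne_zero hu1 (hs u y hu hy)) (fun h => hu.ne' (hg u h).1) h3

theorem StablePair.of_X_mul_eq_of_linear {f g F : ℝ[X]} {c : ℝ} (hc : 0 < c) (hg : UnitRooted g)
    (hf : f = C c * X) (hF : X * F = (X + 1) * (f * g)) : StablePair g F := by
  have hF' : F = C c * (X + 1) * g := mul_left_cancel₀ X_ne_zero (by rw [hF, hf]; ring)
  intro u y hu hy
  have : aeval u F + y * aeval u g = (c * (u + 1) + y) * aeval u g := by
    rw [hF']
    simp only [map_mul, map_add, aeval_X, map_one, aeval_C, Complex.coe_algebraMap]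
    ring
  rw [this]
  refine mul_ne_zero (fun h => ?_) fun h => hu.ne' (hg u h).1
  have him := congrArg Complex.im h
  simp only [Complex.add_im, Complex.im_ofReal_mul, Complex.one_im, add_zero,
    Complex.zero_im] at him
  have := mul_pos hc hu
  linarith

theorem exists_packedPoly_eq_of_subsingleton [Finite α] [Nonempty α] [Subsingleton α]
    (h0 : packedPoly R T ≠ 0) : ∃ c : ℝ, 0 < c ∧ packedPoly R T = C c * X := by
  have hdeg : (packedPoly R T).natDegree ≤ 1 :=
    natDegree_packedPoly_le.trans (Finite.card_le_one_iff_subsingleton.2 inferInstance)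
  have heq : packedPoly R T = C ((packedPoly R T).coeff 1) * X := by
    conv_lhs => rw [eq_X_add_C_of_natDegree_le_one hdeg, coeff_zero_packedPoly, C_0, add_zero]
  refine ⟨_, lt_of_le_of_ne ?_ fun h => h0 ?_, heq⟩
  · rw [coeff_packedPoly]
    positivity
  · rw [heq, ← h, C_0, zero_mul]

theorem packedPoly_sum_of_isEmpty_left [Finite α] [Finite β] [IsEmpty α]
    {R T : α ⊕ β → α ⊕ β → Prop} (hR : ∀ x y, R (Sum.inr x) (Sum.inr y) ↔ R' x y)
    (hT : ∀ x y, T (Sum.inr x) (Sum.inr y) ↔ T' x y) : packedPoly R T = packedPoly R' T' :=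
  (packedPoly_congr (Equiv.emptySum α β).symm (fun x y => (hR x y).symm)
    fun x y => (hT x y).symm).symm

theorem packedPoly_sum_of_isEmpty_right [Finite α] [Finite β] [IsEmpty β]
    {R₀ T₀ : α ⊕ β → α ⊕ β → Prop} (hR : ∀ x y, R₀ (Sum.inl x) (Sum.inl y) ↔ R x y)
    (hT : ∀ x y, T₀ (Sum.inl x) (Sum.inl y) ↔ T x y) : packedPoly R₀ T₀ = packedPoly R T :=
  (packedPoly_congr (Equiv.sumEmpty α β).symm (fun x y => (hR x y).symm)
    fun x y => (hT x y).symm).symm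

theorem ErasureStable.lex_lex [Finite α] [Finite β] (h : ErasureStable R T)
    (h' : ErasureStable R' T') : ErasureStable (Sum.Lex R R') (Sum.Lex T T') := by
  refine .of_sum lex_erase_inl_iff lex_erase_inl_iff lex_erase_inr_iff lex_erase_inr_iff
    ?_ (fun x => ?_) fun x => ?_
  · rw [packedPoly_lex_lex]
    exact h.unitRooted.mul h'.unitRooted
  · rw [packedPoly_lex_lex, packedPoly_lex_lex]
    exact ⟨(h.unitRooted_erase x).mul h'.unitRooted, (h.stablePair x).mul_right h'.unitRooted⟩
  · rw [packedPoly_lex_lex, packedPoly_lex_lex]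
    exact ⟨h.unitRooted.mul (h'.unitRooted_erase x), (h'.stablePair x).mul_left h.unitRooted⟩

theorem subsingleton_of_isEmpty_ne {x : α} (h : IsEmpty {a // a ≠ x}) : Subsingleton α :=
  subsingleton_of_forall_eq x fun a => by
    by_contra ha
    exact h.false ⟨a, ha⟩

theorem ErasureStable.lex_liftRel [Finite α] [Finite β] (h : ErasureStable R T)
    (h' : ErasureStable R' T') : ErasureStable (Sum.Lex R R') (Sum.LiftRel T T') := by
  cases isEmpty_or_nonempty α
  · exact h'.congr (Equiv.emptySum α β).symm (fun x y => by simp) (fun x y => by simp)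
  cases isEmpty_or_nonempty β
  · exact h.congr (Equiv.sumEmpty α β).symm (fun x y => by simp) (fun x y => by simp)
  have hE := X_mul_packedPoly_lex_liftRel (R := R) (T := T) (R' := R') (T' := T')
  have hE' := hE.trans (congrArg _ (mul_comm _ _))
  refine .of_sum lex_erase_inl_iff liftRel_erase_inl_iff lex_erase_inr_iff liftRel_erase_inr_iff
    (h.unitRooted.of_X_mul_eq h'.unitRooted hE) (fun x => ?_) fun x => ?_
  · rcases isEmpty_or_nonempty {a // a ≠ x} with hx | hx
    · rw [packedPoly_sum_of_isEmpty_left (R' := R') (T' := T') (by simp) (by simp)]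
      have := subsingleton_of_isEmpty_ne hx
      obtain ⟨c, hc, hf⟩ := exists_packedPoly_eq_of_subsingleton h.unitRooted.ne_zero
      exact ⟨h'.unitRooted, .of_X_mul_eq_of_linear hc h'.unitRooted hf hE⟩
    · exact ⟨(h.unitRooted_erase x).of_X_mul_eq h'.unitRooted X_mul_packedPoly_lex_liftRel,
        (h.stablePair x).of_X_mul_eq h'.unitRooted hE X_mul_packedPoly_lex_liftRel⟩
  · rcases isEmpty_or_nonempty {b // b ≠ x} with hx | hx
    · rw [packedPoly_sum_of_isEmpty_right (R := R) (T := T) (by simp) (by simp)]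
      have := subsingleton_of_isEmpty_ne hx
      obtain ⟨c, hc, hf⟩ := exists_packedPoly_eq_of_subsingleton h'.unitRooted.ne_zero
      exact ⟨h.unitRooted, .of_X_mul_eq_of_linear hc h.unitRooted hf hE'⟩
    · exact ⟨h.unitRooted.of_X_mul_eq (h'.unitRooted_erase x) X_mul_packedPoly_lex_liftRel,
        (h'.stablePair x).of_X_mul_eq h.unitRooted hE'
          (X_mul_packedPoly_lex_liftRel.trans (congrArg _ (mul_comm _ _)))⟩

theorem packedPoly_liftRel_comm [Finite α] [Finite β] :
    packedPoly (Sum.LiftRel R R') (Sum.LiftRel T T') =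
      packedPoly (Sum.LiftRel R' R) (Sum.LiftRel T' T) :=
  packedPoly_congr (Equiv.sumComm α β) (fun x y => by simp) (fun x y => by simp)

theorem ErasureStable.liftRel [Finite α] [Finite β] (h : ErasureStable R T)
    (h' : ErasureStable R' T') : ErasureStable (Sum.LiftRel R R') (Sum.LiftRel T T') := by
  refine .of_sum liftRel_erase_inl_iff liftRel_erase_inl_iff liftRel_erase_inr_iff
    liftRel_erase_inr_iff ?_ (fun x => ?_) fun x => ?_
  · rw [packedPoly_liftRel]
    exact h.unitRooted.diamond h'.unitRooted
  · rw [packedPoly_liftRel, packedPoly_liftRel]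
    exact ⟨(h.unitRooted_erase x).diamond h'.unitRooted, (h.stablePair x).diamond h'.unitRooted⟩
  · rw [packedPoly_liftRel_comm, packedPoly_liftRel_comm (R := R), packedPoly_liftRel,
      packedPoly_liftRel]
    exact ⟨(h'.unitRooted_erase x).diamond h.unitRooted, (h'.stablePair x).diamond h.unitRooted⟩

theorem unitRooted_one : UnitRooted 1 := by
  intro z hz
  simp at hz

theorem ErasureStable.of_isEmpty [Finite α] [IsEmpty α] : ErasureStable R T :=
  ⟨packedPoly_of_isEmpty (R := R) (T := T) ▸ unitRooted_one, isEmptyElim, isEmptyElim⟩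

theorem ErasureStable.of_subsingleton [Finite α] [Nonempty α] [Subsingleton α]
    (h0 : packedPoly R T ≠ 0) : ErasureStable R T := by
  obtain ⟨c, hc, hf⟩ := exists_packedPoly_eq_of_subsingleton h0
  have herase : ∀ x, packedPoly (eraseRel R x) (eraseRel T x) = 1 := fun x =>
    have : IsEmpty {a // a ≠ x} := ⟨fun a => a.2 (Subsingleton.elim _ _)⟩
    packedPoly_of_isEmpty
  refine ⟨fun z hz => ?_, fun x => herase x ▸ unitRooted_one, fun x u y hu hy h => ?_⟩
  · rw [hf, map_mul, aeval_C, aeval_X, Complex.coe_algebraMap, mul_eq_zero,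
      Complex.ofReal_eq_zero] at hz
    rw [hz.resolve_left hc.ne']
    simp
  · rw [herase, hf, map_mul, aeval_C, aeval_X, map_one, mul_one, Complex.coe_algebraMap] at h
    have him := congrArg Complex.im h
    rw [Complex.add_im, Complex.im_ofReal_mul, Complex.zero_im] at him
    have := mul_pos hc hu
    linarith

end Invariant

theorem lt_iff_lt_of_injective {α : Type*} {f g : α → ℕ} (hf : Function.Injective f)
    (h : ∀ x y, f x < f y → g x < g y) (x y : α) : f x < f y ↔ g x < g y := by
  refine ⟨h x y, fun hg => ?_⟩
  rcases lt_trichotomy (f x) (f y) with hlt | heq | hgt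
  · exact hlt
  · exact absurd (hf heq) (fun hxy => hg.ne (congrArg g hxy))
  · exact absurd (h y x hgt) hg.not_gt

theorem SeriesParallel.erasureStable {S : LPoset} (hS : SeriesParallel S) :
    ErasureStable (α := S.carrier) (· ≤ ·) (StrictDescent S.label) := by
  induction hS with
  | empty S h => exact .of_isEmpty
  | single S h =>
    have := (Nat.card_eq_one_iff_unique.1 h).1
    have := (Nat.card_eq_one_iff_unique.1 h).2
    refine .of_subsingleton ?_
    rw [← Epoly_eq_packedPoly, ← leadingCoeff_ne_zero]
    exact (leadingCoeff_Epoly_pos _).ne'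
  | osum0 P Q _ _ μ hμ h1 h2 h3 hP hQ =>
    refine (hP.lex_liftRel hQ).congr toLex (fun x y => Sum.Lex.toLex_le_toLex.symm) ?_
    rintro (x | x) (y | y)
    · simp [StrictDescent, lt_iff_lt_of_injective P.inj h1]
    · simp [StrictDescent, (h3 x y).le]
    · simp [StrictDescent]
    · simp [StrictDescent, lt_iff_lt_of_injective Q.inj h2]
  | osum1 P Q _ _ μ hμ h1 h2 h3 hP hQ =>
    refine (hP.lex_lex hQ).congr toLex (fun x y => Sum.Lex.toLex_le_toLex.symm) ?_
    rintro (x | x) (y | y)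
    · simp [StrictDescent, lt_iff_lt_of_injective P.inj h1]
    · simp [StrictDescent, h3 y x]
    · simp [StrictDescent]
    · simp [StrictDescent, lt_iff_lt_of_injective Q.inj h2]
  | dunion P Q _ _ μ hμ h1 h2 hP hQ =>
    refine (hP.liftRel hQ).congr (Equiv.refl _) (fun x y => Iff.rfl) ?_
    rintro (x | x) (y | y)
    · simp [StrictDescent, lt_iff_lt_of_injective P.inj h1]
    · simp [StrictDescent]
    · simp [StrictDescent]
    · simp [StrictDescent, lt_iff_lt_of_injective Q.inj h2]

/-- **Corollary 3.3.** If `(S,μ)` is a series-parallel labelled poset and `x ∈ S`, then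
`E(S,μ)` and `E(S∖x, μ)` are real-rooted and `E(S∖x, μ) ⪯ E(S,μ)`. -/
theorem series_parallel_interlacing (S : LPoset) (hS : SeriesParallel S) (x : S.carrier) :
    RealRooted (Epoly S.carrier S.label) ∧
    RealRooted (Epoly {y : S.carrier // y ≠ x} (fun y => S.label y.val)) ∧
    Interlaces (Epoly {y : S.carrier // y ≠ x} (fun y => S.label y.val))
      (Epoly S.carrier S.label) := by
  have h := hS.erasureStable
  have hE := h.unitRooted
  have hE' := h.unitRooted_erase x
  have hs := h.stablePair x
  rw [← Epoly_eq_packedPoly] at hE hs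
  change UnitRooted (packedPoly (· ≤ ·) (StrictDescent fun y : {y // y ≠ x} => S.label y)) at hE'
  change StablePair (packedPoly (· ≤ ·) (StrictDescent fun y : {y // y ≠ x} => S.label y)) _ at hs
  rw [← Epoly_eq_packedPoly] at hE' hs
  refine ⟨hE.realRooted, hE'.realRooted, hs.interlaces hE hE' (leadingCoeff_Epoly_pos _)
    (leadingCoeff_Epoly_pos _) ?_⟩
  classical
  have := Fintype.ofFinite S.carrier
  have hpos : 0 < Nat.card S.carrier := Nat.card_pos_iff.2 ⟨⟨x⟩, inferInstance⟩
  rw [natDegree_Epoly, natDegree_Epoly, Nat.card_eq_fintype_card (α := {y // y ≠ x}),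
    Fintype.card_subtype_compl, Fintype.card_subtype_eq, ← Nat.card_eq_fintype_card]
  omega
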